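/- arXiv:1208.1203 — 2 statements merged into one kernel-verified Lean document; each statement's English description precedes it below -/
import Mathlib

section
/- Let X = {x_j}_{j≥1} be a sequence of pairwise distinct points of ℝ³ and let φ_j ∈ L²(ℝ³) be given by φ_j(x) = e^{−|x−x_j|}/|x−x_j|. Then the sequence {φ_j}_{j≥1} forms a Riesz basis of the closure of its linear span in L²(ℝ³) — equivalently, it is simultaneously a Riesz-Fischer sequence and a Bessel sequence in L²(ℝ³) — if and only if d_*(X) > 0. -/
open MeasureTheory Filter
open scoped ComplexOrder ENNReal RealInnerProductSpace

noncomputable section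

/-- The Hilbert space `ℓ²(ℕ)` of square-summable complex sequences. -/
abbrev ell2 : Type := lp (fun _ : ℕ => ℂ) 2

/-- The standard basis vector `e k` of `ℓ²(ℕ)`. -/
def stdBasis (k : ℕ) : ell2 := lp.single 2 k (1 : ℂ)

/-- A sequence in a normed space is a *Riesz–Fischer sequence* if there is `c > 0` with
`‖∑_{k<m} ξ_k f_k‖² ≥ c ∑_{k<m} |ξ_k|²` for all `m` and all coefficients `ξ`. -/
def IsRieszFischerSeq {F : Type*} [NormedAddCommGroup F] [NormedSpace ℂ F] (f : ℕ → F) : Prop :=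
  ∃ c : ℝ, 0 < c ∧ ∀ (m : ℕ) (ξ : Fin m → ℂ),
    c * ∑ k, ‖ξ k‖ ^ 2 ≤ ‖∑ k, ξ k • f (k : ℕ)‖ ^ 2

/-- A sequence in a normed space is a *Bessel sequence* if there is `C > 0` with
`‖∑_{k<m} ξ_k f_k‖² ≤ C ∑_{k<m} |ξ_k|²` for all `m` and all coefficients `ξ`. -/
def IsBesselSeq {F : Type*} [NormedAddCommGroup F] [NormedSpace ℂ F] (f : ℕ → F) : Prop :=
  ∃ C : ℝ, 0 < C ∧ ∀ (m : ℕ) (ξ : Fin m → ℂ),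
    ‖∑ k, ξ k • f (k : ℕ)‖ ^ 2 ≤ C * ∑ k, ‖ξ k‖ ^ 2

/-- `g` is *strongly `X`-positive definite*: there is `c > 0` such that for every finite
choice of distinct points from (the range of) `X` and all complex coefficients `ξ`,
`∑_{j,k} ξ_k conj(ξ_j) g(y_k − y_j) ≥ c ∑_k |ξ_k|²` (inequality in the complex order). -/
def IsStronglyPosDef {E : Type*} [NormedAddCommGroup E] (X : ℕ → E) (g : E → ℂ) : Prop :=
  ∃ c : ℝ, 0 < c ∧ ∀ (m : ℕ) (y : Fin m → E),
    (∀ i, y i ∈ Set.range X) → Function.Injective y → ∀ ξ : Fin m → ℂ,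
      ((c * ∑ k, ‖ξ k‖ ^ 2 : ℝ) : ℂ) ≤ ∑ j, ∑ k, ξ k * (starRingEnd ℂ) (ξ j) * g (y k - y j)

/-- `g` is a *positive definite function*: it is continuous at `0` and all quadratic forms
`∑_{j,k} ξ_k conj(ξ_j) g(x_k − x_j)` are nonnegative (in the complex order). -/
def IsPosDefFn {E : Type*} [NormedAddCommGroup E] (g : E → ℂ) : Prop :=
  ContinuousAt g 0 ∧ ∀ (m : ℕ) (x : Fin m → E) (ξ : Fin m → ℂ),
    (0 : ℂ)≤ ∑ j, ∑ k, ξ k * (starRingEnd ℂ) (ξ j) * g (x k - x j)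

/-- `d_*(X) > 0`: the points of the sequence `X` are uniformly separated. -/
def SeparatedSeq {E : Type*} [MetricSpace E] (X : ℕ → E) : Prop :=
  ∃ d : ℝ, 0 < d ∧ ∀ k j, k ≠ j → d ≤ dist (X k) (X j)

/-- The upper density `D*(Λ)` of a real sequence: the (limsup form of the) limit of
`n(r)/r`, where `n(r)` is the largest number of terms of `Λ` lying in an interval
of length `r`. -/
def upperDensity (Λ : ℕ → ℝ) : ℝ≥0∞ :=
  Filter.limsup (fun r : ℝ =>
    (⨆ a : ℝ, ∑' _ : {k : ℕ // Λ k ∈ Set.Icc a (a + r)}, (1 : ℝ≥0∞)) / ENNReal.ofReal r)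
    Filter.atTop

abbrev E3 : Type := EuclideanSpace ℝ (Fin 3)

lemma integrable_exp_neg_norm3 : Integrable (fun x : E3 => Real.exp (-‖x‖)) := by
  rw [integrable_fun_norm_addHaar (volume : Measure E3) (f := fun r => Real.exp (-r))]
  have h := integrableOn_rpow_mul_exp_neg_mul_rpow (p := 1) (s := 2) (b := 1)
    (by norm_num) one_pos one_pos
  refine h.congr_fun (fun x hx => ?_) measurableSet_Ioi
  simp

lemma integrable_exp_neg_norm_div3 :
    Integrable (fun x : E3 => Real.exp (-‖x‖) / ‖x‖ ^ 2) := by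
  rw [integrable_fun_norm_addHaar (volume : Measure E3) (f := fun r => Real.exp (-r) / r ^ 2)]
  refine (integrableOn_exp_neg_Ioi 0).congr_fun (fun x hx => ?_) measurableSet_Ioi
  have : (x : ℝ) ≠ 0 := ne_of_gt hx
  simp
  field_simp

lemma L2_norm_sq (f : Lp ℂ 2 (volume : Measure E3)) : ‖f‖ ^ 2 = ∫ x, ‖f x‖ ^ 2 := by
  have h := @inner_self_eq_norm_sq ℂ _ _ _ _ f
  rw [← h, L2.inner_def]
  rw [show (∫ a, inner ℂ (f a) (f a)) = ((∫ x, ‖f x‖ ^ 2 : ℝ) : ℂ) from ?_]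
  · simp
  · rw [← integral_complex_ofReal]
    congr 1; ext x
    rw [inner_self_eq_norm_sq_to_K]; simp

lemma L2_integrable (f : Lp ℂ 2 (volume : Measure E3)) : Integrable (fun x => ‖f x‖ ^ 2) :=
  (memLp_two_iff_integrable_sq_norm (Lp.aestronglyMeasurable f)).1 (Lp.memLp f)

lemma sep_sum_bound (X : ℕ → E3) (hs : SeparatedSeq X) :
    ∃ S : ℝ, 0 < S ∧ ∀ (m : ℕ) (x : E3), ∑ k : Fin m, Real.exp (-dist x (X k)) ≤ S := by
  obtain ⟨d, hd, hsep⟩ := hs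
  set r := d / 2 with hr
  have hr0 : 0 < r := by positivity
  set V := (volume : Measure E3).real (Metric.ball 0 r) with hV
  have hV0 : 0 < V := by
    rw [hV, measureReal_def]
    exact ENNReal.toReal_pos (Metric.measure_ball_pos _ _ hr0).ne' measure_ball_lt_top.ne
  set I := ∫ x : E3, Real.exp (-‖x‖)
  have hI0 : 0 ≤ I := integral_nonneg fun x => (Real.exp_pos _).le
  refine ⟨Real.exp r * I / V + 1, by positivity, fun m x => ?_⟩
  have hVk : ∀ y : E3, (volume : Measure E3).real (Metric.ball y r) = V := by
    intro y
    rw [hV, measureReal_def, measureReal_def, Measure.addHaar_ball_center]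
  have hint : Integrable (fun y : E3 => Real.exp (-dist x y)) := by
    have := integrable_exp_neg_norm3.comp_sub_left x
    simpa [dist_eq_norm] using this
  have hI : ∫ y : E3, Real.exp (-dist x y) = I := by
    have := integral_sub_left_eq_self (fun y : E3 => Real.exp (-‖y‖)) volume x
    simpa [dist_eq_norm] using this
  have h1 : ∀ k : Fin m, V * (Real.exp (-r) * Real.exp (-dist x (X k))) ≤
      ∫ y in Metric.ball (X k) r, Real.exp (-dist x y) := by
    intro k
    have hc : ∫ y in Metric.ball (X k) r, (Real.exp (-r) * Real.exp (-dist x (X k)))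
        = V * (Real.exp (-r) * Real.exp (-dist x (X k))) := by
      rw [setIntegral_const, hVk]; simp
    rw [← hc]
    refine setIntegral_mono_on (integrableOn_const (measure_ball_lt_top.ne)) hint.integrableOn
      measurableSet_ball fun y hy => ?_
    rw [← Real.exp_add]
    apply Real.exp_le_exp.2
    have := dist_triangle x (X k) y
    rw [Metric.mem_ball, dist_comm] at hy
    linarith
  have h2 : ∑ k : Fin m, ∫ y in Metric.ball (X k) r, Real.exp (-dist x y) ≤ I := by
    rw [← integral_iUnion_fintype (fun _ => measurableSet_ball) ?_ (fun _ => hint.integrableOn), ← hI]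
    · exact setIntegral_le_integral hint (Eventually.of_forall fun y => (Real.exp_pos _).le)
    · intro i j hij
      apply Metric.ball_disjoint_ball
      have := hsep i j (fun h => hij (Fin.ext h))
      linarith
  have h3 := (Finset.sum_le_sum fun k (_ : k ∈ Finset.univ) => h1 k).trans h2
  rw [← Finset.mul_sum, ← Finset.mul_sum] at h3
  have h4 : ∑ k : Fin m, Real.exp (-dist x (X k)) ≤ Real.exp r * I / V := by
    rw [le_div_iff₀ hV0]
    have := mul_le_mul_of_nonneg_left h3 (Real.exp_pos r).le
    have he : Real.exp r * Real.exp (-r) = 1 := by rw [← Real.exp_add]; simp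
    calc _ = (Real.exp r * Real.exp (-r)) * (V * ∑ k : Fin m, Real.exp (-dist x (X k))) := by
          rw [he]; ring
      _ ≤ _ := by linarith
  linarith

lemma coe_sum_ae (X : ℕ → E3) (φ : ℕ → Lp ℂ 2 (volume : Measure E3))
    (hφ : ∀ j, (φ j : E3 → ℂ) =ᵐ[volume] fun x =>
      ((Real.exp (-dist x (X j)) / dist x (X j) : ℝ) : ℂ)) (m : ℕ) (ξ : Fin m → ℂ) :
    ((∑ k, ξ k • φ (k : ℕ) : Lp ℂ 2 (volume : Measure E3)) : E3 → ℂ) =ᵐ[volume] fun x =>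
      ∑ k, ξ k * ((Real.exp (-dist x (X k)) / dist x (X k) : ℝ) : ℂ) := by
  have h0 := Lp.coeFn_finsetSum Finset.univ (fun k : Fin m => ξ k • φ (k : ℕ))
  have h1 : ∀ᵐ x, ∀ k : Fin m, (ξ k • φ (k : ℕ) : Lp ℂ 2 (volume : Measure E3)) x = ξ k • φ (k : ℕ) x :=
    ae_all_iff.2 fun k => Lp.coeFn_smul (ξ k) (φ k)
  have h2 : ∀ᵐ x, ∀ k : Fin m, φ (k : ℕ) x = ((Real.exp (-dist x (X k)) / dist x (X k) : ℝ) : ℂ) :=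
    ae_all_iff.2 fun k => hφ k
  filter_upwards [h0, h1, h2] with x a0 a1 a2
  rw [a0]
  simp only [Finset.sum_apply]
  refine Finset.sum_congr rfl fun k _ => ?_
  rw [a1, a2, smul_eq_mul]

lemma bessel_of_sep (X : ℕ → E3) (φ : ℕ → Lp ℂ 2 (volume : Measure E3))
    (hφ : ∀ j, (φ j : E3 → ℂ) =ᵐ[volume] fun x =>
      ((Real.exp (-dist x (X j)) / dist x (X j) : ℝ) : ℂ)) (hs : SeparatedSeq X) :
    IsBesselSeq φ := by
  obtain ⟨S, hS, hb⟩ := sep_sum_bound X hs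
  set J := ∫ x : E3, Real.exp (-‖x‖) / ‖x‖ ^ 2
  have hJ : 0 ≤ J := integral_nonneg fun x => by positivity
  refine ⟨S * J + 1, by positivity, fun m ξ => ?_⟩
  have hint : ∀ k : Fin m, Integrable (fun x : E3 =>
      ‖ξ k‖ ^ 2 * (Real.exp (-dist x (X k)) / dist x (X k) ^ 2)) := by
    intro k
    have := (integrable_exp_neg_norm_div3.comp_sub_right (X k)).const_mul (‖ξ k‖ ^ 2)
    simpa [dist_eq_norm] using this
  have hJk : ∀ k : Fin m, ∫ x : E3, Real.exp (-dist x (X k)) / dist x (X k) ^ 2 = J := by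
    intro k
    have := integral_sub_right_eq_self (μ := volume)
      (fun x : E3 => Real.exp (-‖x‖) / ‖x‖ ^ 2) (X k)
    simpa [dist_eq_norm] using this
  rw [L2_norm_sq]
  have key : ∫ x, ‖(∑ k, ξ k • φ (k : ℕ) : Lp ℂ 2 (volume : Measure E3)) x‖ ^ 2 ≤
      ∫ x, S * ∑ k : Fin m, ‖ξ k‖ ^ 2 * (Real.exp (-dist x (X k)) / dist x (X k) ^ 2) := by
    refine integral_mono_ae (L2_integrable _)
      ((integrable_finsetSum _ fun k _ => hint k).const_mul S) ?_
    filter_upwards [coe_sum_ae X φ hφ m ξ] with x hx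
    rw [hx]
    have h1 : ‖∑ k : Fin m, ξ k * ((Real.exp (-dist x (X k)) / dist x (X k) : ℝ) : ℂ)‖ ≤
        ∑ k : Fin m, ‖ξ k‖ * (Real.exp (-dist x (X k)) / dist x (X k)) := by
      refine (norm_sum_le _ _).trans (Finset.sum_le_sum fun k _ => ?_)
      rw [norm_mul, Complex.norm_real, Real.norm_of_nonneg (by positivity)]
    have h2 := Finset.sum_sq_le_sum_mul_sum_of_sq_eq_mul (Finset.univ : Finset (Fin m))
      (r := fun k : Fin m => ‖ξ k‖ * (Real.exp (-dist x (X k)) / dist x (X k)))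
      (f := fun k : Fin m => Real.exp (-dist x (X k)))
      (g := fun k : Fin m => ‖ξ k‖ ^ 2 * (Real.exp (-dist x (X k)) / dist x (X k) ^ 2))
      (fun i _ => by positivity) (fun i _ => by positivity) (fun i _ => by
        simp only [mul_pow, div_pow]; ring)
    calc _ ≤ _ := pow_le_pow_left₀ (norm_nonneg _) h1 2
      _ ≤ _ := h2
      _ ≤ _ := mul_le_mul_of_nonneg_right (hb m x) (Finset.sum_nonneg fun i _ => by positivity)
  refine key.trans ?_
  rw [integral_const_mul, integral_finsetSum _ fun k _ => hint k]
  simp only [integral_const_mul, hJk]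
  rw [← Finset.sum_mul]
  have : 0 ≤ ∑ k : Fin m, ‖ξ k‖ ^ 2 := Finset.sum_nonneg fun i _ => by positivity
  nlinarith

lemma rf_of_sep (X : ℕ → E3) (φ : ℕ → Lp ℂ 2 (volume : Measure E3))
    (hφ : ∀ j, (φ j : E3 → ℂ) =ᵐ[volume] fun x =>
      ((Real.exp (-dist x (X j)) / dist x (X j) : ℝ) : ℂ)) (hs : SeparatedSeq X) :
    IsRieszFischerSeq φ := by
  obtain ⟨S, hS, hb⟩ := sep_sum_bound X hs
  obtain ⟨d, hd, hsep⟩ := hs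
  set M := 2 * Real.exp 1 / d with hM
  have hM0 : 0 < M := by positivity
  -- choose the radius
  obtain ⟨e, he0, hed, he1, heA⟩ : ∃ e : ℝ, 0 < e ∧ e ≤ d / 2 ∧ e ≤ 1 ∧
      2 * S * M ≤ Real.exp (-1) / e := by
    refine ⟨min (d / 2) (min 1 (Real.exp (-1) / (2 * S * M))), by positivity,
      min_le_left _ _, (min_le_right _ _).trans (min_le_left _ _), ?_⟩
    rw [le_div_iff₀ (by positivity), mul_comm, ← le_div_iff₀ (by positivity)]
    exact (min_le_right _ _).trans (min_le_right _ _)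
  set A := Real.exp (-1) / e with hA
  have hA0 : 0 < A := by positivity
  set V := (volume : Measure E3).real (Metric.ball 0 e) with hV
  have hV0 : 0 < V := by
    rw [hV, measureReal_def]
    exact ENNReal.toReal_pos (Metric.measure_ball_pos _ _ he0).ne' measure_ball_lt_top.ne
  have hVk : ∀ y : E3, (volume : Measure E3).real (Metric.ball y e) = V := by
    intro y
    rw [hV, measureReal_def, measureReal_def, Measure.addHaar_ball_center]
  refine ⟨V * A ^ 2 / 4, by positivity, fun m ξ => ?_⟩
  set f : Lp ℂ 2 (volume : Measure E3) := ∑ k, ξ k • φ (k : ℕ) with hf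
  have hfi := L2_integrable f
  rw [L2_norm_sq]
  set T : Fin m → ℝ := fun k => ∑ j : Fin m, ‖ξ j‖ ^ 2 * Real.exp (-dist (X k) (X j)) with hT
  -- local estimate
  have hloc : ∀ k : Fin m, V * (A ^ 2 * ‖ξ k‖ ^ 2) ≤
      2 * (∫ x in Metric.ball (X k) e, ‖f x‖ ^ 2) + V * (2 * M ^ 2 * S * T k) := by
    intro k
    have hc : ∀ c : ℝ, ∫ x in Metric.ball (X k) e, c = V * c := by
      intro c; rw [setIntegral_const, hVk]; simp
    rw [← hc, ← hc, ← integral_const_mul, ← integral_add (hfi.integrableOn.const_mul 2)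
      (integrableOn_const (measure_ball_lt_top.ne))]
    refine setIntegral_mono_on_ae (integrableOn_const (measure_ball_lt_top.ne))
      ((hfi.integrableOn.const_mul 2).add (integrableOn_const (measure_ball_lt_top.ne)))
      measurableSet_ball ?_
    have hne : ∀ᵐ x : E3, x ≠ X k := by
      simp [ae_iff]
    filter_upwards [coe_sum_ae X φ hφ m ξ, hne] with x hx hxk hxb
    rw [Metric.mem_ball] at hxb
    have hpos : 0 < dist x (X k) := dist_pos.2 hxk
    have hAx : A ≤ Real.exp (-dist x (X k)) / dist x (X k) := by
      rw [hA]
      apply div_le_div₀ (Real.exp_pos _).le (Real.exp_le_exp.2 (by linarith)) hpos hxb.le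
    set R := ∑ j ∈ Finset.univ.erase k, ξ j * ((Real.exp (-dist x (X j)) / dist x (X j) : ℝ) : ℂ)
      with hR
    have hsplit : f x = ξ k * ((Real.exp (-dist x (X k)) / dist x (X k) : ℝ) : ℂ) + R := by
      rw [hx, hR]
      exact (Finset.add_sum_erase _ (fun j : Fin m => ξ j *
        ((Real.exp (-dist x (X j)) / dist x (X j) : ℝ) : ℂ)) (Finset.mem_univ k)).symm
    have h1 : ‖R‖ ≤ ∑ j : Fin m, ‖ξ j‖ * (M * Real.exp (-dist (X k) (X j))) := by
      refine (norm_sum_le _ _).trans ?_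
      refine (Finset.sum_le_sum fun j hj => ?_).trans
        (Finset.sum_le_sum_of_subset_of_nonneg (Finset.erase_subset k _)
          (fun i _ _ => by positivity))
      rw [norm_mul, Complex.norm_real, Real.norm_of_nonneg (by positivity)]
      refine mul_le_mul_of_nonneg_left ?_ (norm_nonneg _)
      have hjk : (k : ℕ) ≠ j := fun h => (Finset.ne_of_mem_erase hj) (Fin.ext h.symm)
      have hd1 := hsep k j hjk
      have htri := dist_triangle (X k) x (X j)
      rw [dist_comm (X k) x] at htri
      have : M * Real.exp (-dist (X k) (X j)) = Real.exp (1 - dist (X k) (X j)) / (d / 2) := by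
        rw [hM, sub_eq_add_neg, Real.exp_add]; field_simp
      rw [this]
      exact div_le_div₀ (Real.exp_pos _).le (Real.exp_le_exp.2 (by linarith)) (by positivity)
        (by linarith)
    have h2 := Finset.sum_sq_le_sum_mul_sum_of_sq_eq_mul (Finset.univ : Finset (Fin m))
      (r := fun j : Fin m => ‖ξ j‖ * (M * Real.exp (-dist (X k) (X j))))
      (f := fun j : Fin m => Real.exp (-dist (X k) (X j)))
      (g := fun j : Fin m => M ^ 2 * (‖ξ j‖ ^ 2 * Real.exp (-dist (X k) (X j))))
      (fun i _ => by positivity) (fun i _ => by positivity) (fun i _ => by ring)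
    rw [← Finset.mul_sum] at h2
    have hTk : 0 ≤ T k := Finset.sum_nonneg fun i _ => by positivity
    have h3 : ‖R‖ ^ 2 ≤ S * (M ^ 2 * T k) :=
      calc _ ≤ _ := pow_le_pow_left₀ (norm_nonneg _) h1 2
        _ ≤ _ := h2
        _ ≤ _ := mul_le_mul_of_nonneg_right (hb m (X k)) (by positivity)
    have h4 : A * ‖ξ k‖ ≤ ‖f x‖ + ‖R‖ := by
      calc A * ‖ξ k‖ ≤ ‖ξ k * ((Real.exp (-dist x (X k)) / dist x (X k) : ℝ) : ℂ)‖ := by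
            rw [norm_mul, Complex.norm_real, Real.norm_of_nonneg (by positivity), mul_comm]
            exact mul_le_mul_of_nonneg_left hAx (norm_nonneg _)
        _ = ‖f x - R‖ := by rw [hsplit]; simp
        _ ≤ _ := norm_sub_le _ _
    have h5 := pow_le_pow_left₀ (by positivity) h4 2
    nlinarith [sq_nonneg (‖f x‖ - ‖R‖)]
  have hsum : ∑ k : Fin m, ∫ x in Metric.ball (X k) e, ‖f x‖ ^ 2 ≤ ∫ x, ‖f x‖ ^ 2 := by
    rw [← integral_iUnion_fintype (fun _ => measurableSet_ball) ?_ (fun _ => hfi.integrableOn)]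
    · exact setIntegral_le_integral hfi (Eventually.of_forall fun y => by positivity)
    · intro i j hij
      apply Metric.ball_disjoint_ball
      have := hsep i j (fun h => hij (Fin.ext h))
      linarith
  have hTsum : ∑ k, T k ≤ S * ∑ k : Fin m, ‖ξ k‖ ^ 2 := by
    rw [hT, Finset.sum_comm, Finset.mul_sum]
    refine Finset.sum_le_sum fun j _ => ?_
    rw [← Finset.mul_sum, mul_comm]
    refine mul_le_mul_of_nonneg_right ?_ (by positivity)
    have := hb m (X j)
    simpa only [dist_comm] using this
  have h6 := Finset.sum_le_sum fun k (_ : k ∈ Finset.univ) => hloc k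
  rw [Finset.sum_add_distrib, ← Finset.mul_sum, ← Finset.mul_sum, ← Finset.mul_sum,
    ← Finset.mul_sum, ← Finset.mul_sum] at h6
  set N := ∑ k : Fin m, ‖ξ k‖ ^ 2
  have hN : 0 ≤ N := Finset.sum_nonneg fun i _ => by positivity
  have h7 : V * (2 * M ^ 2 * S * ∑ k, T k) ≤ V * (2 * M ^ 2 * S * (S * N)) := by gcongr
  have h8 : (2 * S * M) ^ 2 ≤ A ^ 2 := pow_le_pow_left₀ (by positivity) heA 2
  have h9 : (V * N) * (2 * S * M) ^ 2 ≤ (V * N) * A ^ 2 :=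
    mul_le_mul_of_nonneg_left h8 (by positivity)
  nlinarith

lemma sep_of_rf (X : ℕ → E3) (φ : ℕ → Lp ℂ 2 (volume : Measure E3))
    (hφ : ∀ j, (φ j : E3 → ℂ) =ᵐ[volume] fun x =>
      ((Real.exp (-dist x (X j)) / dist x (X j) : ℝ) : ℂ)) (h : IsRieszFischerSeq φ) :
    SeparatedSeq X := by
  obtain ⟨c, hc, h⟩ := h
  have hlow : ∀ k j, k ≠ j → c ≤ ‖φ k - φ j‖ ^ 2 := by
    intro k j hkj
    have hk : k < k + j + 1 := by omega
    have hj : j < k + j + 1 := by omega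
    have hne : (⟨k, hk⟩ : Fin (k + j + 1)) ≠ ⟨j, hj⟩ := fun h => hkj (Fin.mk.inj h)
    have := h (k + j + 1) (Pi.single ⟨k, hk⟩ 1 - Pi.single ⟨j, hj⟩ 1)
    simp only [Pi.sub_apply, sub_smul, Finset.sum_sub_distrib] at this
    have e1 : ∀ (i : ℕ) (hi : i < k + j + 1), ∑ x : Fin (k + j + 1),
        (Pi.single (⟨i, hi⟩ : Fin (k + j + 1)) (1 : ℂ) : Fin (k + j + 1) → ℂ) x • φ x = φ i := by
      intro i hi
      rw [Finset.sum_eq_single ⟨i, hi⟩]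
      · simp
      · intro b _ hb; simp [hb]
      · simp
    rw [e1, e1] at this
    refine le_trans ?_ this
    have h1 := Finset.single_le_sum (s := Finset.univ) (f := fun x : Fin (k + j + 1) =>
      ‖(Pi.single (⟨k, hk⟩ : Fin (k + j + 1)) (1 : ℂ) : Fin (k + j + 1) → ℂ) x -
        (Pi.single (⟨j, hj⟩ : Fin (k + j + 1)) (1 : ℂ) : Fin (k + j + 1) → ℂ) x‖ ^ 2)
      (fun i _ => by positivity) (Finset.mem_univ ⟨k, hk⟩)
    simp [hne] at h1
    nlinarith
  -- continuity of translations
  haveI : Fact ((2 : ℝ≥0∞) ≠ ∞) := ⟨by simp⟩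
  have hcont : Continuous fun a : E3 => (DomAddAct.mk a +ᵥ φ 0 : Lp ℂ 2 (volume : Measure E3)) :=
    (DomAddAct.continuous_mk).vadd continuous_const
  have hc0 := Metric.continuous_iff.1 hcont 0 (Real.sqrt c) (Real.sqrt_pos.2 hc)
  obtain ⟨δ, hδ, hc1⟩ := hc0
  have htr : ∀ j, φ j = (DomAddAct.mk (X 0 - X j) +ᵥ φ 0 : Lp ℂ 2 (volume : Measure E3)) := by
    intro j
    apply Lp.ext
    have h1 := DomAddAct.vadd_Lp_ae_eq (DomAddAct.mk (X 0 - X j)) (φ 0)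
    have h2 := (measurePreserving_add_left volume (X 0 - X j)).quasiMeasurePreserving.ae (hφ 0)
    filter_upwards [h1, h2, hφ j] with x a1 a2 a3
    rw [a1, a3]
    simp only [Equiv.symm_apply_apply, vadd_eq_add]
    rw [a2]
    have : dist (X 0 - X j + x) (X 0) = dist x (X j) := by
      rw [dist_eq_norm, dist_eq_norm]; congr 1; abel
    rw [this]
  refine ⟨δ, hδ, fun k j hkj => ?_⟩
  by_contra! hlt
  have h1 := hlow k j hkj
  have h2 : ‖φ k - φ j‖ < Real.sqrt c := by
    have h3 := hc1 (X j - X k) (by rwa [dist_zero_right, ← dist_eq_norm, dist_comm])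
    rw [← dist_eq_norm]
    have e : φ k = (DomAddAct.mk (X 0 - X j) +ᵥ (DomAddAct.mk (X j - X k) +ᵥ φ 0) :
        Lp ℂ 2 (volume : Measure E3)) := by
      rw [htr k, vadd_vadd, ← DomAddAct.mk_add]
      congr 2; abel
    have e' : φ j = (DomAddAct.mk (X 0 - X j) +ᵥ (DomAddAct.mk (0 : E3) +ᵥ φ 0) :
        Lp ℂ 2 (volume : Measure E3)) := by
      rw [htr j, vadd_vadd, ← DomAddAct.mk_add]
      congr 2; abel
    rw [e, e', DomAddAct.dist_vadd_Lp]
    exact h3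
  have h4 := pow_lt_pow_left₀ h2 (norm_nonneg _) two_ne_zero
  rw [Real.sq_sqrt hc.le] at h4
  linarith

/-- Let `X` be a sequence of pairwise distinct points of `ℝ³` and let
`φ_j(x) = e^{−|x−x_j|}/|x−x_j| ∈ L²(ℝ³)`. Then `{φ_j}` forms a Riesz basis of the closure
of its linear span — equivalently, it is simultaneously a Riesz–Fischer sequence and a
Bessel sequence in `L²(ℝ³)` — iff `d_*(X) > 0`. -/
theorem statement_18 (X : ℕ → EuclideanSpace ℝ (Fin 3)) (hX : Function.Injective X)
    (φ : ℕ → Lp ℂ 2 (volume : Measure (EuclideanSpace ℝ (Fin 3))))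
    (hφ : ∀ j, (φ j : EuclideanSpace ℝ (Fin 3) → ℂ) =ᵐ[volume] fun x =>
      ((Real.exp (-dist x (X j)) / dist x (X j) : ℝ) : ℂ)) :
    (IsRieszFischerSeq φ ∧ IsBesselSeq φ) ↔ SeparatedSeq X := by
  exact ⟨fun h => sep_of_rf X φ hφ h.1, fun h => ⟨rf_of_sep X φ hφ h, bessel_of_sep X φ hφ h⟩⟩
end
end

section
/- Let X = {x_j}_{j≥1} be a sequence of pairwise distinct points of ℝ³ which has no finite accumulation point, and let φ_j ∈ L²(ℝ³) be given by φ_j(x) = e^{−|x−x_j|}/|x−x_j|. Then the normalized sequence {(2π)^{−1/2} φ_j}_{j≥1} forms a Bari basis of the closure of its linear span — that is, there exists an orthonormal basis {g_j}_{j≥1} of the closed linear span of {φ_j : j ∈ ℕ} in L²(ℝ³) with Σ_{j=1}^∞ ‖(2π)^{−1/2} φ_j − g_j‖² < ∞ — if and only if Σ_{j≠k} e^{−2|x_j − x_k|} < ∞. -/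
open MeasureTheory Filter
open scoped ComplexOrder ENNReal RealInnerProductSpace

noncomputable section

theorem aux_sq3 (x A B C : ℝ) (hx : 0 ≤ x) (h : x ≤ A + B + C) :
    x ^ 2 ≤ 3 * (A ^ 2 + B ^ 2 + C ^ 2) := by
  have : x ^ 2 ≤ (A + B + C) ^ 2 := pow_le_pow_left₀ hx h 2
  nlinarith [sq_nonneg (A - B), sq_nonneg (A - C), sq_nonneg (B - C)]

theorem aux_bari_forward {E : Type*} [NormedAddCommGroup E] [InnerProductSpace ℂ E]
    (f g : ℕ → E) (hg : Orthonormal ℂ g) (h : Summable fun j => ‖f j - g j‖ ^ 2) :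
    Summable fun p : ℕ × ℕ => if p.1 = p.2 then (0 : ℝ) else ‖inner ℂ (f p.1) (f p.2)‖ ^ 2 := by
  set d : ℕ → E := fun j => f j - g j with hd
  have h1 : Summable fun p : ℕ × ℕ => ‖inner ℂ (g p.2) (d p.1)‖ ^ 2 := by
    rw [summable_prod_of_nonneg (fun _ => by positivity)]
    refine ⟨fun j => hg.inner_products_summable (x := d j), ?_⟩
    exact Summable.of_nonneg_of_le (fun j => tsum_nonneg (fun _ => by positivity))
      (fun j => hg.tsum_inner_products_le (x := d j)) h
  have h2 : Summable fun p : ℕ × ℕ => ‖inner ℂ (g p.1) (d p.2)‖ ^ 2 :=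
    h1.prod_symm
  have h3 : Summable fun p : ℕ × ℕ => ‖d p.1‖ ^ 2 * ‖d p.2‖ ^ 2 :=
    h.mul_of_nonneg h (fun _ => by positivity) (fun _ => by positivity)
  refine Summable.of_nonneg_of_le (fun p => by split_ifs <;> positivity) (fun p => ?_)
    (((h1.add h2).add h3).mul_left 3)
  split_ifs with hp
  · positivity
  · have e : inner ℂ (f p.1) (f p.2) =
        inner ℂ (d p.1) (g p.2) + inner ℂ (g p.1) (d p.2) + inner ℂ (d p.1) (d p.2) := by
      have h0 : inner ℂ (g p.1) (g p.2) = 0 := hg.2 hp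
      simp only [hd, inner_sub_left, inner_sub_right, h0]
      ring
    have n1 : ‖inner ℂ (d p.1) (g p.2)‖ = ‖inner ℂ (g p.2) (d p.1)‖ := norm_inner_symm _ _
    have n3 : ‖inner ℂ (d p.1) (d p.2)‖ ≤ ‖d p.1‖ * ‖d p.2‖ := norm_inner_le_norm _ _
    have n4 : ‖inner ℂ (f p.1) (f p.2)‖ ≤ ‖inner ℂ (g p.2) (d p.1)‖ + ‖inner ℂ (g p.1) (d p.2)‖
        + ‖d p.1‖ * ‖d p.2‖ := by
      rw [e]
      refine (norm_add₃_le).trans ?_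
      rw [n1]; gcongr
    have h7 : ‖d p.1‖ ^ 2 * ‖d p.2‖ ^ 2 = (‖d p.1‖ * ‖d p.2‖) ^ 2 := by ring
    have h8 := norm_nonneg (inner ℂ (f p.1) (f p.2))
    rw [h7]
    exact aux_sq3 _ _ _ _ h8 n4

/-- Tail Riesz-Fischer property. -/
def TailRF {E : Type*} [NormedAddCommGroup E] [InnerProductSpace ℂ E] (f : ℕ → E) (N : ℕ) : Prop :=
  ∃ c : ℝ, 0 < c ∧ ∀ (s : Finset ℕ) (ξ : ℕ → ℂ), (∀ k ∈ s, N ≤ k) →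
    c * ∑ k ∈ s, ‖ξ k‖ ^ 2 ≤ ‖∑ k ∈ s, ξ k • f k‖ ^ 2

theorem aux_linInd {E : Type*} [NormedAddCommGroup E] [InnerProductSpace ℂ E]
    (f : ℕ → E) (h : TailRF f 0) : LinearIndependent ℂ f := by
  obtain ⟨c, hc, H⟩ := h
  rw [linearIndependent_iff']
  intro s ξ h0 i hi
  have := H s ξ (fun _ _ => Nat.zero_le _)
  rw [h0] at this
  have h1 : ∑ k ∈ s, ‖ξ k‖ ^ 2 ≤ 0 := by
    by_contra hcon
    push Not at hcon
    have := mul_pos hc hcon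
    simp at *
    linarith
  have h2 := Finset.single_le_sum (f := fun k => ‖ξ k‖ ^ 2) (fun _ _ => by positivity) hi
  have h3 : ‖ξ i‖ ^ 2 ≤ 0 := h2.trans h1
  have : ‖ξ i‖ = 0 := by nlinarith [norm_nonneg (ξ i)]
  simpa using this

theorem aux_dual_bound {E : Type*} [NormedAddCommGroup E] [InnerProductSpace ℂ E]
    (f : ℕ → E) (c : ℝ) (hc : 0 < c) (s : Finset ℕ) (ξ : ℕ → ℂ)
    (H : c * ∑ k ∈ s, ‖ξ k‖ ^ 2 ≤ ‖∑ k ∈ s, ξ k • f k‖ ^ 2) (v : E)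
    (hv : inner ℂ v (∑ k ∈ s, ξ k • f k) = ((‖∑ k ∈ s, ξ k • f k‖ ^ 2 : ℝ) : ℂ)) :
    ‖∑ k ∈ s, ξ k • f k‖ ^ 2 ≤ c⁻¹ * ∑ k ∈ s, ‖inner ℂ v (f k)‖ ^ 2 := by
  set p := ∑ k ∈ s, ξ k • f k with hp
  have h1 : ‖p‖ ^ 2 ≤ ∑ k ∈ s, ‖ξ k‖ * ‖inner ℂ v (f k)‖ := by
    have : ‖inner ℂ v p‖ = ‖p‖ ^ 2 := by
      rw [hv, Complex.norm_real, Real.norm_of_nonneg (by positivity)]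
    rw [← this, hp, inner_sum]
    refine (norm_sum_le _ _).trans (le_of_eq ?_)
    simp [inner_smul_right]
  have h2 := Finset.sum_mul_sq_le_sq_mul_sq s (fun k => ‖ξ k‖) (fun k => ‖inner ℂ v (f k)‖)
  set A := ∑ k ∈ s, ‖ξ k‖ ^ 2
  set B := ∑ k ∈ s, ‖inner ℂ v (f k)‖ ^ 2
  have hB : 0 ≤ B := Finset.sum_nonneg (fun _ _ => by positivity)
  have h3 : (‖p‖ ^ 2) ^ 2 ≤ A * B := (pow_le_pow_left₀ (by positivity) h1 2).trans h2
  rcases eq_or_lt_of_le (show 0 ≤ ‖p‖ ^ 2 by positivity) with h0 | h0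
  · rw [← h0]; positivity
  · rw [inv_mul_eq_div, le_div_iff₀ hc]
    have : (‖p‖ ^ 2) * (‖p‖ ^ 2 * c) ≤ ‖p‖ ^ 2 * B := by nlinarith
    exact le_of_mul_le_mul_left this h0

theorem aux_bari_backward {E : Type*} [NormedAddCommGroup E] [InnerProductSpace ℂ E]
    [CompleteSpace E] (f : ℕ → E) (h1 : ∀ j, ‖f j‖ = 1) (hRF : TailRF f 0)
    (hs : Summable fun p : ℕ × ℕ => if p.1 = p.2 then (0 : ℝ) else ‖inner ℂ (f p.1) (f p.2)‖ ^ 2)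
    (S : Submodule ℂ E) (hS : Submodule.span ℂ (Set.range f) = S) :
    ∃ g : HilbertBasis ℕ ℂ S.topologicalClosure,
      Summable fun j => ‖f j - (g j : S.topologicalClosure)‖ ^ 2 := by
  have hli := aux_linInd f hRF
  obtain ⟨c, hc, H⟩ := hRF
  have hon := InnerProductSpace.gramSchmidtNormed_orthonormal hli
  set g := InnerProductSpace.gramSchmidtNormed ℂ f with hg
  have hspan : Submodule.span ℂ (Set.range g) = S := by
    rw [hg, InnerProductSpace.span_gramSchmidtNormed_range, InnerProductSpace.span_gramSchmidt, hS]
  have hgm : ∀ j, g j ∈ S.topologicalClosure := fun j =>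
    S.le_topologicalClosure (hspan ▸ Submodule.subset_span ⟨j, rfl⟩)
  let g' : ℕ → S.topologicalClosure := fun j => ⟨g j, hgm j⟩
  have hon' : Orthonormal ℂ g' := by
    have := hon.codRestrict S.topologicalClosure hgm
    exact this
  have hcs : CompleteSpace S.topologicalClosure := inferInstance
  have hdense : ⊤ ≤ (Submodule.span ℂ (Set.range g')).topologicalClosure := by
    rintro ⟨x, hx⟩ -
    have hmap : (Submodule.span ℂ (Set.range g')).map S.topologicalClosure.subtype = S := by
      rw [Submodule.map_span, ← Set.range_comp]
      exact hspan
    change (⟨x, hx⟩ : S.topologicalClosure) ∈ closure (Submodule.span ℂ (Set.range g') : Set S.topologicalClosure)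
    rw [closure_subtype]
    change x ∈ closure ((Submodule.span ℂ (Set.range g')).map S.topologicalClosure.subtype : Set E)
    rw [hmap]
    exact hx
  refine ⟨HilbertBasis.mk hon' hdense, ?_⟩
  simp only [HilbertBasis.coe_mk]
  change Summable fun j => ‖f j - g j‖ ^ 2
  have hsum : Summable fun j => ∑' k, if j = k then (0 : ℝ) else ‖inner ℂ (f j) (f k)‖ ^ 2 :=
    ((summable_prod_of_nonneg (fun p => by dsimp; split_ifs <;> positivity)).1 hs).2
  refine Summable.of_nonneg_of_le (fun j => by positivity) (fun n => ?_) (hsum.mul_left (2 * c⁻¹))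
  set q := InnerProductSpace.gramSchmidt ℂ f n with hq
  set p := f n - q with hp
  have hpm : p ∈ Submodule.span ℂ (f '' (Finset.range n : Set ℕ)) := by
    have : (Finset.range n : Set ℕ) = Set.Iio n := by ext; simp
    rw [this, ← InnerProductSpace.span_gramSchmidt_Iio, hp, hq, InnerProductSpace.gramSchmidt_def,
      sub_sub_cancel]
    refine Submodule.sum_mem _ fun i hi => ?_
    rw [Submodule.starProjection_singleton]
    exact Submodule.smul_mem _ _ (Submodule.subset_span ⟨i, by simpa using hi, rfl⟩)
  obtain ⟨ξ, hξ⟩ : ∃ ξ : ℕ → ℂ, ∑ k ∈ Finset.range n, ξ k • f k = p := by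
    obtain ⟨ξ, hξ⟩ := (Submodule.mem_span_image_finset_iff_exists_fun ℂ).1 hpm
    refine ⟨fun k => if h : k ∈ Finset.range n then ξ ⟨k, h⟩ else 0, ?_⟩
    rw [← hξ, ← Finset.sum_coe_sort]
    refine Finset.sum_congr rfl fun k _ => ?_
    dsimp only
    rw [dif_pos k.2]
  have hqp : inner ℂ q p = 0 := by
    rw [← hξ, inner_sum]
    refine Finset.sum_eq_zero fun i hi => ?_
    rw [inner_smul_right, hq, InnerProductSpace.gramSchmidt_inv_triangular ℂ f (Finset.mem_range.1 hi),
      mul_zero]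
  have hfn : f n = q + p := by rw [hp]; abel
  have hfp : inner ℂ (f n) p = ((‖p‖ ^ 2 : ℝ) : ℂ) := by
    rw [hfn, inner_add_left, hqp, zero_add, inner_self_eq_norm_sq_to_K]; simp
  have hb := aux_dual_bound f c hc (Finset.range n) ξ
    (H _ _ (fun _ _ => Nat.zero_le _)) (f n) (by rw [hξ]; exact hfp)
  rw [hξ] at hb
  have hle : ∑ k ∈ Finset.range n, ‖inner ℂ (f n) (f k)‖ ^ 2 ≤
      ∑' k, if n = k then (0 : ℝ) else ‖inner ℂ (f n) (f k)‖ ^ 2 := by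
    have hsn := ((summable_prod_of_nonneg (fun p => by dsimp; split_ifs <;> positivity)).1 hs).1 n
    refine le_trans (le_of_eq ?_) (hsn.sum_le_tsum (Finset.range n) (fun k _ => by split_ifs <;> positivity))
    refine Finset.sum_congr rfl fun k hk => ?_
    have : n ≠ k := by have := Finset.mem_range.1 hk; omega
    simp [this]
  have hpyth : ‖q‖ ^ 2 + ‖p‖ ^ 2 = 1 := by
    have := norm_add_sq_eq_norm_sq_add_norm_sq_of_inner_eq_zero q p hqp
    rw [← hfn, h1] at this
    nlinarith
  have hq0 : 0 < ‖q‖ := norm_pos_iff.2 (InnerProductSpace.gramSchmidt_ne_zero n hli)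
  have hgq : ‖q - g n‖ = |‖q‖ - 1| := by
    have : q - g n = ((1 - ‖q‖⁻¹ : ℝ) : ℂ) • q := by
      rw [hg, InnerProductSpace.gramSchmidtNormed, ← hq]
      simp [sub_smul]
    rw [this, norm_smul, Complex.norm_real, Real.norm_eq_abs]
    rw [← abs_of_pos hq0, ← abs_mul, abs_of_pos hq0]
    congr 1
    field_simp
  have hfg : ‖f n - g n‖ ≤ ‖p‖ + |‖q‖ - 1| := by
    have : f n - g n = p + (q - g n) := by rw [hp]; abel
    rw [this, ← hgq]
    exact norm_add_le _ _
  have hfg2 : ‖f n - g n‖ ^ 2 ≤ 2 * ‖p‖ ^ 2 := by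
    have horth : inner ℂ p (q - g n) = 0 := by
      have : q - g n = ((1 - ‖q‖⁻¹ : ℝ) : ℂ) • q := by
        rw [hg, InnerProductSpace.gramSchmidtNormed, ← hq]
        simp [sub_smul]
      rw [this, inner_smul_right, ← inner_conj_symm, hqp]; simp
    have e : f n - g n = p + (q - g n) := by rw [hp]; abel
    have := norm_add_sq_eq_norm_sq_add_norm_sq_of_inner_eq_zero _ _ horth
    rw [← e, hgq] at this
    have h5 := abs_mul_abs_self (‖q‖ - 1)
    have h6 : ‖q‖ ≤ 1 := by nlinarith [sq_nonneg ‖p‖]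
    nlinarith
  calc _ ≤ 2 * ‖p‖ ^ 2 := hfg2
    _ ≤ 2 * (c⁻¹ * ∑' k, if n = k then (0 : ℝ) else ‖inner ℂ (f n) (f k)‖ ^ 2) := by
      have := mul_le_mul_of_nonneg_left hle (inv_pos.2 hc).le
      linarith
    _ = _ := by ring

theorem aux_tail {E : Type*} [NormedAddCommGroup E] [InnerProductSpace ℂ E]
    (f : ℕ → E) (h1 : ∀ j, ‖f j‖ = 1)
    (hs : Summable fun p : ℕ × ℕ => if p.1 = p.2 then (0 : ℝ) else ‖inner ℂ (f p.1) (f p.2)‖ ^ 2) :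
    ∃ N, TailRF f N := by
  set a : ℕ × ℕ → ℝ := fun p => if p.1 = p.2 then (0 : ℝ) else ‖inner ℂ (f p.1) (f p.2)‖ ^ 2 with ha
  obtain ⟨T, hT⟩ := (summable_iff_vanishing_norm.1 hs) (1 / 4) (by norm_num)
  obtain ⟨N, hN⟩ := (T.image Prod.fst).exists_nat_subset_range
  refine ⟨N, 1 / 2, by norm_num, fun s ξ hsN => ?_⟩
  have hdis : Disjoint (s ×ˢ s) T := by
    rw [Finset.disjoint_left]
    rintro p hp hpT
    have := Finset.mem_range.1 (hN (Finset.mem_image_of_mem _ hpT))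
    have := hsN _ (Finset.mem_product.1 hp).1
    omega
  have h4 := hT _ hdis
  rw [Real.norm_eq_abs] at h4
  have h4 := (le_abs_self _).trans h4.le
  set A := ∑ k ∈ s, ‖ξ k‖ ^ 2 with hA
  have hA0 : 0 ≤ A := Finset.sum_nonneg (fun _ _ => by positivity)
  let b : ℕ × ℕ → ℝ := fun p => if p.1 = p.2 then (0 : ℝ) else ‖inner ℂ (f p.1) (f p.2)‖
  have hcs := Finset.sum_mul_sq_le_sq_mul_sq (s ×ˢ s) (fun p => ‖ξ p.1‖ * ‖ξ p.2‖) b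
  have e1 : ∑ p ∈ s ×ˢ s, (‖ξ p.1‖ * ‖ξ p.2‖) ^ 2 = A ^ 2 := by
    rw [Finset.sum_product, hA, sq, Finset.sum_mul_sum]
    simp only [mul_pow]
  have e2 : ∑ p ∈ s ×ˢ s, b p ^ 2 = ∑ p ∈ s ×ˢ s, a p := by
    refine Finset.sum_congr rfl fun p _ => ?_
    simp only [b, ha]; split_ifs <;> simp
  rw [e1, e2] at hcs
  set R := ∑ p ∈ s ×ˢ s, ‖ξ p.1‖ * ‖ξ p.2‖ * b p with hR
  have hR2 : R ≤ A / 2 := by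
    refine le_of_not_gt fun hcon => ?_
    have : (A / 2) ^ 2 < R ^ 2 := pow_lt_pow_left₀ hcon (by positivity) two_ne_zero
    nlinarith [mul_le_mul_of_nonneg_left h4 (sq_nonneg A)]
  have hexp : ‖∑ k ∈ s, ξ k • f k‖ ^ 2 ≥ A - R := by
    have e3 : ((‖∑ k ∈ s, ξ k • f k‖ ^ 2 : ℝ) : ℂ) = (A : ℂ) +
        ∑ p ∈ s ×ˢ s, (if p.1 = p.2 then 0 else
          (starRingEnd ℂ) (ξ p.1) * (ξ p.2) * inner ℂ (f p.1) (f p.2)) := by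
      have : ((‖∑ k ∈ s, ξ k • f k‖ ^ 2 : ℝ) : ℂ) =
        inner ℂ (∑ k ∈ s, ξ k • f k) (∑ k ∈ s, ξ k • f k) := by
        rw [inner_self_eq_norm_sq_to_K]; simp
      rw [this, sum_inner, Finset.sum_product, hA]
      push_cast
      rw [← Finset.sum_add_distrib]
      refine Finset.sum_congr rfl fun k hk => ?_
      rw [inner_sum, ← Finset.add_sum_erase _ _ hk, ← Finset.add_sum_erase _ _ hk]
      simp only [inner_smul_left, inner_smul_right, if_true, zero_add]
      congr 1
      · rw [inner_self_eq_norm_sq_to_K, h1]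
        simp
        rw [Complex.mul_conj']
      · refine Finset.sum_congr rfl fun l hl => ?_
        rw [if_neg (Finset.ne_of_mem_erase hl).symm]
        ring
    set W := ∑ p ∈ s ×ˢ s, (if p.1 = p.2 then (0 : ℂ) else
          (starRingEnd ℂ) (ξ p.1) * (ξ p.2) * inner ℂ (f p.1) (f p.2)) with hW
    have hWR : ‖W‖ ≤ R := by
      refine (norm_sum_le _ _).trans (Finset.sum_le_sum fun p _ => ?_)
      simp only [b]
      split_ifs <;> simp
    have e4 : ‖∑ k ∈ s, ξ k • f k‖ ^ 2 = A + W.re := by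
      have := congrArg Complex.re e3
      simpa [-Complex.ofReal_pow] using this
    have := (abs_le.1 (Complex.abs_re_le_norm W)).1
    rw [e4]; linarith
  linarith

theorem aux_step {E : Type*} [NormedAddCommGroup E] [InnerProductSpace ℂ E]
    (f : ℕ → E) (N : ℕ) (h : TailRF f (N + 1))
    (hcl : f N ∉ closure (Submodule.span ℂ (f '' Set.Ici (N + 1)) : Set E)) : TailRF f N := by
  obtain ⟨c, hc, H⟩ := h
  rw [Metric.mem_closure_iff] at hcl
  push Not at hcl
  obtain ⟨δ, hδ, hcl⟩ := hcl
  -- distance bound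
  have key : ∀ (s : Finset ℕ) (ξ : ℕ → ℂ) (z : ℂ), (∀ k ∈ s, N + 1 ≤ k) →
      δ * ‖z‖ ≤ ‖z • f N + ∑ k ∈ s, ξ k • f k‖ := by
    intro s ξ z hsN
    by_cases hz : z = 0
    · simp [hz]
    have hm : -(z⁻¹ • ∑ k ∈ s, ξ k • f k) ∈ Submodule.span ℂ (f '' Set.Ici (N + 1)) := by
      refine Submodule.neg_mem _ (Submodule.smul_mem _ _ (Submodule.sum_mem _ fun k hk =>
        Submodule.smul_mem _ _ (Submodule.subset_span ⟨k, hsN k hk, rfl⟩)))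
    have := hcl _ hm
    rw [dist_eq_norm, sub_neg_eq_add] at this
    have e : z • f N + ∑ k ∈ s, ξ k • f k = z • (f N + z⁻¹ • ∑ k ∈ s, ξ k • f k) := by
      rw [smul_add, smul_inv_smul₀ hz]
    rw [e, norm_smul, mul_comm]
    gcongr
  set M := ‖f N‖ with hM
  -- combine
  have comb : ∃ c' : ℝ, 0 < c' ∧ ∀ (s : Finset ℕ) (ξ : ℕ → ℂ) (z : ℂ), (∀ k ∈ s, N + 1 ≤ k) →
      c' * (‖z‖ ^ 2 + ∑ k ∈ s, ‖ξ k‖ ^ 2) ≤ ‖z • f N + ∑ k ∈ s, ξ k • f k‖ ^ 2 := by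
    set D := 1 / δ ^ 2 + 2 * (1 + M ^ 2 / δ ^ 2) / c with hD
    have hD0 : 0 < D := by positivity
    refine ⟨D⁻¹, by positivity, fun s ξ z hsN => ?_⟩
    have k1 := key s ξ z hsN
    have k2 := H s ξ hsN
    set v := ∑ k ∈ s, ξ k • f k with hv
    set A := ∑ k ∈ s, ‖ξ k‖ ^ 2
    set w := ‖z • f N + v‖ with hw
    have k3 : ‖v‖ ≤ w + ‖z‖ * M := by
      have : v = (z • f N + v) - z • f N := by abel
      rw [this, hM, ← norm_smul]
      exact norm_sub_le _ _
    have hz : ‖z‖ ≤ w / δ := by rw [le_div_iff₀ hδ]; linarith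
    have hz2 : ‖z‖ ^ 2 ≤ w ^ 2 / δ ^ 2 := by
      rw [← div_pow]; gcongr
    have hA : A ≤ (2 * (1 + M ^ 2 / δ ^ 2) / c) * w ^ 2 := by
      have : ‖v‖ ^ 2 ≤ 2 * w ^ 2 + 2 * M ^ 2 * ‖z‖ ^ 2 := by
        have : ‖v‖ ^ 2 ≤ (w + ‖z‖ * M) ^ 2 := by gcongr
        nlinarith [sq_nonneg (w - ‖z‖ * M)]
      have h5 : 2 * M ^ 2 * ‖z‖ ^ 2 ≤ 2 * M ^ 2 * (w ^ 2 / δ ^ 2) := by gcongr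
      have h6 : c * A ≤ 2 * (1 + M ^ 2 / δ ^ 2) * w ^ 2 := by
        calc _ ≤ _ := k2
          _ ≤ 2 * w ^ 2 + 2 * M ^ 2 * (w ^ 2 / δ ^ 2) := by linarith
          _ = _ := by ring
      rw [div_mul_eq_mul_div, le_div_iff₀ hc]
      linarith
    rw [inv_mul_le_iff₀ hD0]
    calc _ ≤ w ^ 2 / δ ^ 2 + (2 * (1 + M ^ 2 / δ ^ 2) / c) * w ^ 2 := by linarith
      _ = _ := by rw [hD]; ring
  obtain ⟨c', hc', hcomb⟩ := comb
  refine ⟨c', hc', fun s ξ hsN => ?_⟩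
  have hser : ∀ k ∈ s.erase N, N + 1 ≤ k := by
    intro k hk
    have := hsN k (Finset.mem_of_mem_erase hk)
    have := Finset.ne_of_mem_erase hk
    omega
  by_cases hNs : N ∈ s
  · rw [← Finset.add_sum_erase _ _ hNs, ← Finset.add_sum_erase _ _ hNs]
    exact hcomb _ _ _ hser
  · have := hcomb (s.erase N) ξ 0 hser
    rw [Finset.erase_eq_of_notMem hNs] at this
    simpa using this

theorem aux_gauss_full : ∫⁻ w : ℝ, ENNReal.ofReal (Real.exp (-w ^ 2)) = ENNReal.ofReal (√Real.pi) := by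
  have h := integral_gaussian 1
  have hi := integrable_exp_neg_mul_sq (b := 1) one_pos
  rw [← ofReal_integral_eq_lintegral_ofReal (by simpa using hi) (ae_of_all _ fun _ => by positivity)]
  congr 1
  simpa using h

theorem aux_glasser_pos (c : ℝ) (hc : 0 < c) :
    ∫⁻ v in Set.Ioi (0 : ℝ), ENNReal.ofReal (Real.exp (-(v - c / v) ^ 2)) =
      ENNReal.ofReal (√Real.pi / 2) := by
  set F : ℝ → ℝ≥0∞ := fun w => ENNReal.ofReal (Real.exp (-w ^ 2)) with hF
  have hFm : Measurable F := by rw [hF]; fun_prop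
  set J := ∫⁻ v in Set.Ioi (0 : ℝ), F (v - c / v) with hJ
  -- first substitution
  have s1 : ∫⁻ w, F w = ∫⁻ v in Set.Ioi (0 : ℝ), ENNReal.ofReal |1 + c / v ^ 2| * F (v - c / v) := by
    rw [← lintegral_image_eq_lintegral_abs_deriv_mul (f := fun v => v - c / v) measurableSet_Ioi]
    · have : (fun v : ℝ => v - c / v) '' Set.Ioi 0 = Set.univ := by
        ext w
        simp only [Set.mem_image, Set.mem_Ioi, Set.mem_univ, iff_true]
        have hs : √(w ^ 2 + 4 * c) ^ 2 = w ^ 2 + 4 * c := Real.sq_sqrt (by positivity)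
        have hpos : 0 < w + √(w ^ 2 + 4 * c) := by
          have : |w| < √(w ^ 2 + 4 * c) := by
            rw [← Real.sqrt_sq_eq_abs]
            exact Real.sqrt_lt_sqrt (by positivity) (by linarith)
          have := (abs_lt.1 this).1
          linarith
        refine ⟨(w + √(w ^ 2 + 4 * c)) / 2, by positivity, ?_⟩
        field_simp
        nlinarith
      rw [this, Measure.restrict_univ]
    · intro v hv
      have hv : v ≠ 0 := (Set.mem_Ioi.1 hv).ne'
      have := ((hasDerivAt_id v).sub ((hasDerivAt_inv hv).const_mul c)).hasDerivWithinAt (s := Set.Ioi 0)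
      convert! this using 1
      field_simp; ring
    · have : StrictMonoOn (fun v : ℝ => v - c / v) (Set.Ioi 0) := by
        intro a ha b hb hab
        have := div_lt_div_of_pos_left hc ha hab
        dsimp only
        linarith
      exact this.injOn
  have s2 : J = ∫⁻ v in Set.Ioi (0 : ℝ), ENNReal.ofReal (c / v ^ 2) * F (v - c / v) := by
    have hinj : Set.InjOn (fun v : ℝ => c / v) (Set.Ioi 0) := by
      intro a ha b hb hab
      have ha : a ≠ 0 := (Set.mem_Ioi.1 ha).ne'
      have hb : b ≠ 0 := (Set.mem_Ioi.1 hb).ne'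
      dsimp only at hab
      field_simp at hab
      exact hab.symm
    have := lintegral_image_eq_lintegral_abs_deriv_mul (f := fun v => c / v) (f' := fun v => -(c / v ^ 2))
      (s := Set.Ioi 0) measurableSet_Ioi (by
        intro v hv
        have hv : v ≠ 0 := (Set.mem_Ioi.1 hv).ne'
        have := ((hasDerivAt_inv hv).const_mul c).hasDerivWithinAt (s := Set.Ioi 0)
        convert! this using 1
        field_simp) hinj (fun v => F (v - c / v))
    have him : (fun v : ℝ => c / v) '' Set.Ioi 0 = Set.Ioi 0 := by
      ext w
      simp only [Set.mem_image, Set.mem_Ioi]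
      constructor
      · rintro ⟨v, hv, rfl⟩; positivity
      · intro hw; exact ⟨c / w, by positivity, by field_simp⟩
    rw [him] at this
    rw [hJ, this]
    refine setLIntegral_congr_fun measurableSet_Ioi fun v hv => ?_
    have hv0 : 0 < v := hv
    rw [abs_neg, abs_of_pos (by positivity)]
    congr 1
    simp only [hF]
    congr 3
    field_simp
    ring
  have s3 : ∫⁻ w, F w = J + J := by
    rw [s1]
    conv_rhs => rw [s2]
    nth_rewrite 1 [← s2]
    rw [hJ, ← lintegral_add_left (by fun_prop)]
    refine setLIntegral_congr_fun measurableSet_Ioi fun v hv => ?_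
    have hv0 : 0 < v := hv
    rw [abs_of_pos (by positivity), ENNReal.ofReal_add (by positivity) (by positivity), add_mul]
    simp
  rw [aux_gauss_full, ← two_mul] at s3
  rw [ENNReal.ofReal_div_of_pos (by norm_num), s3]
  rw [ENNReal.ofReal_ofNat, mul_comm, ENNReal.mul_div_cancel_right (by norm_num) (by norm_num)]

theorem aux_glasser (c : ℝ) (hc : 0 ≤ c) :
    ∫⁻ v in Set.Ioi (0 : ℝ), ENNReal.ofReal (Real.exp (-v ^ 2 - c ^ 2 / v ^ 2)) =
      ENNReal.ofReal (√Real.pi / 2 * Real.exp (-(2 * c))) := by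
  rcases hc.eq_or_lt with rfl | hc
  · have h := integral_gaussian_Ioi 1
    have hi := (integrable_exp_neg_mul_sq (b := 1) one_pos).restrict (s := Set.Ioi 0)
    rw [← ofReal_integral_eq_lintegral_ofReal (by simpa using hi) (ae_of_all _ fun _ => by positivity)]
    congr 1
    simpa using h
  · rw [ENNReal.ofReal_mul (by positivity), ← aux_glasser_pos c hc, ← lintegral_mul_const _ (by fun_prop)]
    refine setLIntegral_congr_fun measurableSet_Ioi fun v hv => ?_
    have hv0 : 0 < v := hv
    rw [← ENNReal.ofReal_mul (by positivity), ← Real.exp_add]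
    congr 2
    field_simp
    ring

theorem aux_rep (r : ℝ) (hr : 0 < r) :
    ∫⁻ t in Set.Ioi (0 : ℝ), ENNReal.ofReal (1 / (t * √t) * Real.exp (-t - r ^ 2 / (4 * t))) =
      ENNReal.ofReal (2 * √Real.pi * (Real.exp (-r) / r)) := by
  have h := aux_glasser (r / 2) (by positivity)
  have hinj : Set.InjOn (fun t : ℝ => r / (2 * √t)) (Set.Ioi 0) := by
    intro a ha b hb hab
    have ha : 0 < a := ha
    have hb : 0 < b := hb
    have := Real.sqrt_pos.2 ha
    have := Real.sqrt_pos.2 hb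
    dsimp only at hab
    field_simp at hab
    exact ((Real.sqrt_inj hb.le ha.le).1 hab).symm
  have hsub := lintegral_image_eq_lintegral_abs_deriv_mul (f := fun t => r / (2 * √t))
    (f' := fun t => -(r / 4 * (1 / (t * √t))))
    (s := Set.Ioi 0) measurableSet_Ioi (by
      intro t ht
      have ht : 0 < t := ht
      have hs := Real.sqrt_pos.2 ht
      have := (((Real.hasDerivAt_sqrt ht.ne').const_mul 2).inv (by positivity)).const_mul r
      have := this.hasDerivWithinAt (s := Set.Ioi 0)
      convert! this using 1
      have h2 : √t ^ 2 = t := Real.sq_sqrt ht.le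
      field_simp
      rw [h2]; ring) hinj (fun v => ENNReal.ofReal (Real.exp (-v ^ 2 - (r / 2) ^ 2 / v ^ 2)))
  have him : (fun t : ℝ => r / (2 * √t)) '' Set.Ioi 0 = Set.Ioi 0 := by
    ext w
    simp only [Set.mem_image, Set.mem_Ioi]
    constructor
    · rintro ⟨v, hv, rfl⟩
      have := Real.sqrt_pos.2 hv
      positivity
    · intro hw
      refine ⟨(r / (2 * w)) ^ 2, by positivity, ?_⟩
      rw [Real.sqrt_sq (by positivity)]
      field_simp
  rw [him, h] at hsub
  have e : ENNReal.ofReal (2 * √Real.pi * (Real.exp (-r) / r)) =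
      ENNReal.ofReal (4 / r) * ENNReal.ofReal (√Real.pi / 2 * Real.exp (-(2 * (r / 2)))) := by
    rw [← ENNReal.ofReal_mul (by positivity)]
    congr 1
    have : 2 * (r / 2) = r := by ring
    rw [this]
    field_simp; norm_num
  rw [e, hsub, ← lintegral_const_mul _ (by fun_prop)]
  refine setLIntegral_congr_fun measurableSet_Ioi fun t ht => ?_
  have ht : 0 < t := ht
  have hs := Real.sqrt_pos.2 ht
  have h2 : √t ^ 2 = t := Real.sq_sqrt ht.le
  rw [abs_neg, abs_of_pos (by positivity), ← ENNReal.ofReal_mul (by positivity),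
    ← ENNReal.ofReal_mul (by positivity), ← mul_assoc]
  congr 2
  · field_simp
  · congr 1
    rw [div_pow, mul_pow, h2]
    field_simp
    ring

theorem aux_fin (d : ℝ) (hd : 0 ≤ d) :
    ∫⁻ u in Set.Ioi (0 : ℝ), ENNReal.ofReal (1 / √u * Real.exp (-u - d ^ 2 / (4 * u))) =
      ENNReal.ofReal (√Real.pi * Real.exp (-d)) := by
  have h := aux_glasser (d / 2) (by positivity)
  have hinj : Set.InjOn (fun t : ℝ => √t) (Set.Ioi 0) := by
    intro a ha b hb hab
    have ha : 0 < a := ha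
    have hb : 0 < b := hb
    exact ((Real.sqrt_inj ha.le hb.le).1 hab)
  have hsub := lintegral_image_eq_lintegral_abs_deriv_mul (f := fun t => √t)
    (f' := fun t => 1 / (2 * √t))
    (s := Set.Ioi 0) measurableSet_Ioi (by
      intro t ht
      have ht : 0 < t := ht
      exact (Real.hasDerivAt_sqrt ht.ne').hasDerivWithinAt) hinj
      (fun v => ENNReal.ofReal (Real.exp (-v ^ 2 - (d / 2) ^ 2 / v ^ 2)))
  have him : (fun t : ℝ => √t) '' Set.Ioi 0 = Set.Ioi 0 := by
    ext w
    simp only [Set.mem_image, Set.mem_Ioi]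
    constructor
    · rintro ⟨v, hv, rfl⟩
      exact Real.sqrt_pos.2 hv
    · intro hw
      exact ⟨w ^ 2, by positivity, Real.sqrt_sq hw.le⟩
  rw [him, h] at hsub
  have e : ENNReal.ofReal (√Real.pi * Real.exp (-d)) =
      ENNReal.ofReal 2 * ENNReal.ofReal (√Real.pi / 2 * Real.exp (-(2 * (d / 2)))) := by
    rw [← ENNReal.ofReal_mul (by positivity)]
    congr 1
    have : 2 * (d / 2) = d := by ring
    rw [this]
    ring
  rw [e, hsub, ← lintegral_const_mul _ (by fun_prop)]
  refine setLIntegral_congr_fun measurableSet_Ioi fun t ht => ?_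
  have ht : 0 < t := ht
  have hs := Real.sqrt_pos.2 ht
  have h2 : √t ^ 2 = t := Real.sq_sqrt ht.le
  rw [abs_of_pos (by positivity), ← ENNReal.ofReal_mul (by positivity),
    ← ENNReal.ofReal_mul (by positivity), ← mul_assoc]
  congr 2
  · field_simp
  · congr 1
    rw [h2]
    field_simp
    ring

theorem aux_sum (F : ℝ → ℝ≥0∞) (hF : Measurable F) :
    ∫⁻ s in Set.Ioi (0 : ℝ), ∫⁻ t in Set.Ioi (0 : ℝ), F (s + t) =
      ∫⁻ u in Set.Ioi (0 : ℝ), ENNReal.ofReal u * F u := by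
  have h1 : ∀ s : ℝ, ∫⁻ t in Set.Ioi (0 : ℝ), F (s + t) = ∫⁻ u, (Set.Ioi s).indicator F u := by
    intro s
    rw [← lintegral_indicator measurableSet_Ioi, ← lintegral_add_left_eq_self (fun u => (Set.Ioi s).indicator F u) s]
    refine lintegral_congr fun t => ?_
    simp [Set.indicator]
  simp_rw [h1]
  have hm : Measurable (Function.uncurry fun s u : ℝ => (Set.Ioi s).indicator F u) := by
    have : (Function.uncurry fun s u : ℝ => (Set.Ioi s).indicator F u) =
        Set.indicator {p : ℝ × ℝ | p.1 < p.2} (fun p => F p.2) := by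
      ext ⟨s, u⟩; simp [Set.indicator]
    rw [this]
    exact (hF.comp measurable_snd).indicator (measurableSet_lt measurable_fst measurable_snd)
  rw [lintegral_lintegral_swap hm.aemeasurable, ← lintegral_indicator measurableSet_Ioi]
  refine lintegral_congr fun u => ?_
  have : ∀ s, (Set.Ioi s).indicator F u = (Set.Iio u).indicator (fun _ => F u) s := by
    intro s; simp [Set.indicator]
  simp_rw [this]
  rw [lintegral_indicator measurableSet_Iio, lintegral_const, Measure.restrict_restrict measurableSet_Iio,
    Measure.restrict_apply_univ, Set.inter_comm, Set.Ioi_inter_Iio, Real.volume_Ioo, sub_zero, mul_comm]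
  by_cases hu : 0 < u
  · simp [hu]
  · simp [hu, ENNReal.ofReal_of_nonpos (not_lt.1 hu)]

theorem aux_gauss3 (α β : ℝ) (hα : 0 < α) (hβ : 0 < β) (a b : EuclideanSpace ℝ (Fin 3)) :
    ∫⁻ x, ENNReal.ofReal (Real.exp (-(α * dist x a ^ 2) - β * dist x b ^ 2)) =
      ENNReal.ofReal ((Real.pi / (α + β)) * √(Real.pi / (α + β)) *
        Real.exp (-(α * β / (α + β) * dist a b ^ 2))) := by
  have hab : 0 < α + β := by positivity
  have hg := GaussianFourier.integral_rexp_neg_mul_sq_norm (V := EuclideanSpace ℝ (Fin 3)) hab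
  have hval : (Real.pi / (α + β)) ^ ((Module.finrank ℝ (EuclideanSpace ℝ (Fin 3)) : ℝ) / 2) =
      (Real.pi / (α + β)) * √(Real.pi / (α + β)) := by
    have h0 : 0 < Real.pi / (α + β) := by positivity
    rw [finrank_euclideanSpace_fin, Real.sqrt_eq_rpow]
    nth_rewrite 2 [← Real.rpow_one (Real.pi / (α + β))]
    rw [← Real.rpow_add h0]; norm_num
  rw [hval] at hg
  have hint : Integrable (fun v : EuclideanSpace ℝ (Fin 3) => Real.exp (-(α + β) * ‖v‖ ^ 2)) := by
    by_contra hcon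
    rw [integral_undef hcon] at hg
    have : 0 < (Real.pi / (α + β)) * √(Real.pi / (α + β)) := by positivity
    linarith
  rw [ENNReal.ofReal_mul (by positivity), ← hg,
    ofReal_integral_eq_lintegral_ofReal hint (ae_of_all _ fun _ => by positivity),
    ← lintegral_mul_const _ (by fun_prop)]
  set m : EuclideanSpace ℝ (Fin 3) := a + (β / (α + β)) • (b - a) with hm
  rw [← lintegral_add_right_eq_self _ m]
  refine lintegral_congr fun y => ?_
  rw [← ENNReal.ofReal_mul (by positivity), ← Real.exp_add]
  congr 2
  set w := b - a with hw
  have e1 : dist (y + m) a = ‖y + (β / (α + β)) • w‖ := by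
    rw [dist_eq_norm, hm]; congr 1; abel
  have e2 : dist (y + m) b = ‖y - (α / (α + β)) • w‖ := by
    rw [dist_eq_norm]; congr 1
    have : b = a + w := by rw [hw]; abel
    rw [hm, this]
    have h1 : w = (β / (α + β)) • w + (α / (α + β)) • w := by
      rw [← add_smul, ← add_div, add_comm β α, div_self hab.ne', one_smul]
    nth_rewrite 2 [h1]
    abel
  have e3 : dist a b = ‖w‖ := by rw [dist_comm, dist_eq_norm]
  rw [e1, e2, e3, norm_add_sq_real, norm_sub_sq_real, inner_smul_right, inner_smul_right, norm_smul,
    norm_smul, Real.norm_of_nonneg (by positivity), Real.norm_of_nonneg (by positivity)]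
  field_simp
  ring

theorem aux_inner_gauss (s t : ℝ) (hs : 0 < s) (ht : 0 < t) (a b : EuclideanSpace ℝ (Fin 3)) :
    ∫⁻ x, ENNReal.ofReal (1 / (s * √s) * Real.exp (-s - dist x a ^ 2 / (4 * s))) *
        ENNReal.ofReal (1 / (t * √t) * Real.exp (-t - dist x b ^ 2 / (4 * t))) =
      ENNReal.ofReal (4 * Real.pi * (2 * √Real.pi)) *
        ENNReal.ofReal (1 / ((s + t) * √(s + t)) *
          Real.exp (-(s + t) - dist a b ^ 2 / (4 * (s + t)))) := by
  have h := aux_gauss3 (1 / (4 * s)) (1 / (4 * t)) (by positivity) (by positivity) a b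
  have hss := Real.sqrt_pos.2 hs
  have hst := Real.sqrt_pos.2 ht
  have e1 : ∀ x, ENNReal.ofReal (1 / (s * √s) * Real.exp (-s - dist x a ^ 2 / (4 * s))) *
        ENNReal.ofReal (1 / (t * √t) * Real.exp (-t - dist x b ^ 2 / (4 * t))) =
      ENNReal.ofReal (1 / (s * √s) * (1 / (t * √t)) * Real.exp (-(s + t))) *
      ENNReal.ofReal (Real.exp (-(1 / (4 * s) * dist x a ^ 2) - 1 / (4 * t) * dist x b ^ 2)) := by
    intro x
    rw [← ENNReal.ofReal_mul (by positivity), ← ENNReal.ofReal_mul (by positivity)]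
    congr 1
    have : Real.exp (-s - dist x a ^ 2 / (4 * s)) * Real.exp (-t - dist x b ^ 2 / (4 * t)) =
        Real.exp (-(s + t)) *
          Real.exp (-(1 / (4 * s) * dist x a ^ 2) - 1 / (4 * t) * dist x b ^ 2) := by
      rw [← Real.exp_add, ← Real.exp_add]; congr 1; ring
    calc _ = 1 / (s * √s) * (1 / (t * √t)) * (Real.exp (-s - dist x a ^ 2 / (4 * s)) *
          Real.exp (-t - dist x b ^ 2 / (4 * t))) := by ring
      _ = _ := by rw [this]; ring
  simp_rw [e1]
  rw [lintegral_const_mul _ (by fun_prop), h, ← ENNReal.ofReal_mul (by positivity),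
    ← ENNReal.ofReal_mul (by positivity)]
  congr 1
  have hu : 0 < s + t := by positivity
  have hsu := Real.sqrt_pos.2 hu
  have e2 : Real.pi / (1 / (4 * s) + 1 / (4 * t)) = 4 * Real.pi * (s * t / (s + t)) := by
    field_simp; ring
  have e3 : √(Real.pi / (1 / (4 * s) + 1 / (4 * t))) = 2 * √Real.pi * (√s * √t / √(s + t)) := by
    rw [e2, Real.sqrt_mul (by positivity), Real.sqrt_mul (by norm_num), Real.sqrt_div (by positivity),
      Real.sqrt_mul hs.le]
    congr 2
    rw [show (4 : ℝ) = 2 ^ 2 by norm_num, Real.sqrt_sq (by norm_num)]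
  have e4 : Real.exp (-(s + t) - dist a b ^ 2 / (4 * (s + t))) = Real.exp (-(s + t)) *
      Real.exp (-(1 / (4 * s) * (1 / (4 * t)) / (1 / (4 * s) + 1 / (4 * t)) * dist a b ^ 2)) := by
    rw [← Real.exp_add]; congr 1
    field_simp
    ring
  rw [e3, e2, e4]
  field_simp

theorem aux_main (a b : EuclideanSpace ℝ (Fin 3)) :
    ∫⁻ x, ENNReal.ofReal (Real.exp (-dist x a) / dist x a * (Real.exp (-dist x b) / dist x b)) =
      ENNReal.ofReal (2 * Real.pi * Real.exp (-dist a b)) := by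
  set H : EuclideanSpace ℝ (Fin 3) → EuclideanSpace ℝ (Fin 3) → ℝ → ℝ≥0∞ := fun p x t =>
    ENNReal.ofReal (1 / (t * √t) * Real.exp (-t - dist x p ^ 2 / (4 * t))) with hH
  have hHm : ∀ p, Measurable (Function.uncurry (H p)) := by
    intro p; rw [hH]; unfold Function.uncurry; fun_prop
  have hrep : ∀ p x, x ≠ p → ∫⁻ t in Set.Ioi (0 : ℝ), H p x t =
      ENNReal.ofReal (2 * √Real.pi * (Real.exp (-dist x p) / dist x p)) :=
    fun p x hx => aux_rep _ (dist_pos.2 hx)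
  have hne : ∀ p : EuclideanSpace ℝ (Fin 3), ∀ᵐ x, x ≠ p := fun p => by
    simp [ae_iff]
  have h1 : ENNReal.ofReal (4 * Real.pi) *
      ∫⁻ x, ENNReal.ofReal (Real.exp (-dist x a) / dist x a * (Real.exp (-dist x b) / dist x b)) =
      ∫⁻ x, ∫⁻ s in Set.Ioi (0 : ℝ), ∫⁻ t in Set.Ioi (0 : ℝ), H a x s * H b x t := by
    rw [← lintegral_const_mul _ (by fun_prop)]
    refine lintegral_congr_ae ?_
    filter_upwards [hne a, hne b] with x hxa hxb
    have m1 : Measurable (H a x) := (hHm a).of_uncurry_left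
    have m2 : Measurable (H b x) := (hHm b).of_uncurry_left
    simp_rw [lintegral_const_mul _ m2]
    rw [lintegral_mul_const _ m1, hrep a x hxa, hrep b x hxb, ← ENNReal.ofReal_mul (by positivity),
      ← ENNReal.ofReal_mul (by positivity)]
    congr 1
    have : √Real.pi ^ 2 = Real.pi := Real.sq_sqrt Real.pi_pos.le
    linear_combination (-4 * (Real.exp (-dist x a) / dist x a * (Real.exp (-dist x b) / dist x b))) * this
  have h2 : ∫⁻ x, ∫⁻ s in Set.Ioi (0 : ℝ), ∫⁻ t in Set.Ioi (0 : ℝ), H a x s * H b x t =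
      ∫⁻ s in Set.Ioi (0 : ℝ), ∫⁻ t in Set.Ioi (0 : ℝ), ∫⁻ x, H a x s * H b x t := by
    have mm : Measurable fun q : (EuclideanSpace ℝ (Fin 3) × ℝ) × ℝ => H a q.1.1 q.1.2 * H b q.1.1 q.2 := by
      have n1 : Measurable fun q : (EuclideanSpace ℝ (Fin 3) × ℝ) × ℝ => H a q.1.1 q.1.2 :=
        (hHm a).comp measurable_fst
      have n2 : Measurable fun q : (EuclideanSpace ℝ (Fin 3) × ℝ) × ℝ => H b q.1.1 q.2 :=
        (hHm b).comp ((measurable_fst.comp measurable_fst).prodMk measurable_snd)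
      exact n1.mul n2
    rw [lintegral_lintegral_swap]
    · refine lintegral_congr fun s => ?_
      rw [lintegral_lintegral_swap]
      have : Measurable (fun q : EuclideanSpace ℝ (Fin 3) × ℝ => ((q.1, s), q.2)) := by fun_prop
      exact (mm.comp this).aemeasurable
    · exact (Measurable.lintegral_prod_right' mm).aemeasurable
  set G : ℝ → ℝ≥0∞ := fun u => ENNReal.ofReal (1 / (u * √u) *
          Real.exp (-u - dist a b ^ 2 / (4 * u))) with hG
  have hGm : Measurable G := by rw [hG]; fun_prop
  have h3 : ∫⁻ s in Set.Ioi (0 : ℝ), ∫⁻ t in Set.Ioi (0 : ℝ), ∫⁻ x, H a x s * H b x t =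
      ENNReal.ofReal (4 * Real.pi * (2 * √Real.pi)) *
        ∫⁻ s in Set.Ioi (0 : ℝ), ∫⁻ t in Set.Ioi (0 : ℝ), G (s + t) := by
    rw [← lintegral_const_mul]
    · refine setLIntegral_congr_fun measurableSet_Ioi fun s hs => ?_
      rw [← lintegral_const_mul _ (by fun_prop)]
      refine setLIntegral_congr_fun measurableSet_Ioi fun t ht => ?_
      exact aux_inner_gauss s t hs ht a b
    · exact Measurable.lintegral_prod_right' (f := fun q : ℝ × ℝ => G (q.1 + q.2)) (by fun_prop)
  have h4 : ∫⁻ u in Set.Ioi (0 : ℝ), ENNReal.ofReal u * G u =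
      ENNReal.ofReal (√Real.pi * Real.exp (-dist a b)) := by
    rw [← aux_fin _ dist_nonneg]
    refine setLIntegral_congr_fun measurableSet_Ioi fun u hu => ?_
    have hu : 0 < u := hu
    have := Real.sqrt_pos.2 hu
    rw [hG, ← ENNReal.ofReal_mul hu.le]
    congr 1
    field_simp
  rw [h2, h3, aux_sum G hGm, h4, ← ENNReal.ofReal_mul (by positivity)] at h1
  have e : 4 * Real.pi * (2 * √Real.pi) * (√Real.pi * Real.exp (-dist a b)) =
      4 * Real.pi * (2 * Real.pi * Real.exp (-dist a b)) := by
    have : √Real.pi ^ 2 = Real.pi := Real.sq_sqrt Real.pi_pos.le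
    linear_combination (8 * Real.pi * Real.exp (-dist a b)) * this
  rw [e, ENNReal.ofReal_mul (p := 4 * Real.pi) (q := 2 * Real.pi * Real.exp (-dist a b)) (by positivity)] at h1
  exact (ENNReal.mul_right_inj (by simp [Real.pi_pos]) ENNReal.ofReal_ne_top).1 h1

theorem aux_inner (X : ℕ → EuclideanSpace ℝ (Fin 3))
    (φ : ℕ → Lp ℂ 2 (volume : Measure (EuclideanSpace ℝ (Fin 3))))
    (hφ : ∀ j, (φ j : EuclideanSpace ℝ (Fin 3) → ℂ) =ᵐ[volume] fun x =>
      ((Real.exp (-dist x (X j)) / dist x (X j) : ℝ) : ℂ)) (j k : ℕ) :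
    inner ℂ (φ j) (φ k) = ((2 * Real.pi * Real.exp (-dist (X j) (X k)) : ℝ) : ℂ) := by
  rw [L2.inner_def]
  have : ∫ x, inner ℂ (φ j x) (φ k x) = ∫ x, ((Real.exp (-dist x (X j)) / dist x (X j) *
      (Real.exp (-dist x (X k)) / dist x (X k)) : ℝ) : ℂ) := by
    refine integral_congr_ae ?_
    filter_upwards [hφ j, hφ k] with x hj hk
    rw [hj, hk, RCLike.inner_apply, Complex.conj_ofReal, mul_comm]
    push_cast; ring
  rw [this, integral_complex_ofReal, integral_eq_lintegral_of_nonneg_ae, aux_main, ENNReal.toReal_ofReal]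
  · positivity
  · exact ae_of_all _ fun x => by positivity
  · exact Measurable.aestronglyMeasurable (by fun_prop)

theorem aux_notin (X : ℕ → EuclideanSpace ℝ (Fin 3)) (hX : Function.Injective X)
    (hacc : ∀ y : EuclideanSpace ℝ (Fin 3), ¬ AccPt y (Filter.principal (Set.range X)))
    (f : ℕ → Lp ℂ 2 (volume : Measure (EuclideanSpace ℝ (Fin 3)))) (ρ : ℝ) (hρ : 0 < ρ)
    (hf : ∀ j, (f j : EuclideanSpace ℝ (Fin 3) → ℂ) =ᵐ[volume] fun x =>
      ((ρ * (Real.exp (-dist x (X j)) / dist x (X j)) : ℝ) : ℂ))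
    (hs : Summable fun p : ℕ × ℕ =>
        if p.1 = p.2 then (0 : ℝ) else Real.exp (-(2 * dist (X p.1) (X p.2))))
    (N : ℕ) (hRF : TailRF f (N + 1)) :
    f N ∉ closure (Submodule.span ℂ (f '' Set.Ici (N + 1)) :
      Set (Lp ℂ 2 (volume : Measure (EuclideanSpace ℝ (Fin 3))))) := by
  intro hmem
  obtain ⟨c, hc, H⟩ := hRF
  obtain ⟨h, hh, hlim⟩ := mem_closure_iff_seq_limit.1 hmem
  have hrepr : ∀ n, ∃ l : ℕ →₀ ℂ, (∀ k ∈ l.support, N + 1 ≤ k) ∧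
      ∑ k ∈ l.support, l k • f k = h n := by
    intro n
    obtain ⟨l, hl, hl2⟩ := (Finsupp.mem_span_image_iff_linearCombination ℂ).1 (hh n)
    refine ⟨l, fun k hk => (Finsupp.mem_supported _ _).1 hl hk, ?_⟩
    rw [← hl2, Finsupp.linearCombination_apply, Finsupp.sum]
  choose l hl hlh using hrepr
  obtain ⟨B, hB⟩ : ∃ B, ∀ n, ‖h n‖ ≤ B := by
    obtain ⟨B, hB⟩ := hlim.norm.bddAbove_range
    exact ⟨B, fun n => hB ⟨n, rfl⟩⟩
  have hQ : ∀ n, ∑ k ∈ (l n).support, ‖l n k‖ ^ 2 ≤ B ^ 2 / c := by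
    intro n
    rw [le_div_iff₀ hc, mul_comm]
    refine (H _ _ (hl n)).trans ?_
    rw [hlh]
    exact pow_le_pow_left₀ (norm_nonneg _) (hB n) 2
  -- separation
  obtain ⟨δ, hδ, hsep⟩ : ∃ δ : ℝ, 0 < δ ∧ ∀ k, k ≠ N → 2 * δ ≤ dist (X N) (X k) := by
    have := hacc (X N)
    rw [accPt_iff_nhds] at this
    push Not at this
    obtain ⟨U, hU, hU2⟩ := this
    obtain ⟨ε, hε, hball⟩ := Metric.mem_nhds_iff.1 hU
    refine ⟨ε / 2, by positivity, fun k hk => ?_⟩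
    by_contra hcon
    push Not at hcon
    have hm : X k ∈ U := hball (by rw [Metric.mem_ball, dist_comm]; linarith)
    exact hk (hX (hU2 _ ⟨hm, ⟨k, rfl⟩⟩))
  have hsN : Summable fun k => if N = k then (0 : ℝ) else Real.exp (-(2 * dist (X N) (X k))) :=
    ((summable_prod_of_nonneg (fun p => by dsimp; split_ifs <;> positivity)).1 hs).1 N
  set S := ∑' k, if N = k then (0 : ℝ) else Real.exp (-(2 * dist (X N) (X k))) with hS
  set K := Real.exp δ / δ with hK
  have hK0 : 0 < K := by positivity
  have hE : ∀ x, dist x (X N) < δ → ∀ k, k ≠ N →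
      Real.exp (-dist x (X k)) / dist x (X k) ≤ K * Real.exp (-dist (X N) (X k)) := by
    intro x hx k hk
    have t1 := dist_triangle (X N) x (X k)
    rw [dist_comm (X N) x] at t1
    have t2 := hsep k hk
    have e : K * Real.exp (-dist (X N) (X k)) = Real.exp (δ - dist (X N) (X k)) / δ := by
      rw [hK, sub_eq_add_neg, Real.exp_add]; ring
    rw [e]
    refine div_le_div₀ (Real.exp_pos _).le (Real.exp_le_exp.2 (by linarith)) hδ (by linarith)
  set M := ρ * K * √(B ^ 2 / c * S) with hM
  have hbound : ∀ n x, dist x (X N) < δ →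
      ‖∑ k ∈ (l n).support, l n k * ((ρ * (Real.exp (-dist x (X k)) / dist x (X k)) : ℝ) : ℂ)‖ ≤ M := by
    intro n x hx
    have hne : ∀ k ∈ (l n).support, k ≠ N := fun k hk => by have := hl n k hk; omega
    calc _ ≤ ∑ k ∈ (l n).support, ‖l n k‖ * (ρ * (K * Real.exp (-dist (X N) (X k)))) := by
          refine (norm_sum_le _ _).trans (Finset.sum_le_sum fun k hk => ?_)
          rw [norm_mul, Complex.norm_real, Real.norm_of_nonneg (by positivity)]
          have := hE x hx k (hne k hk)
          gcongr
      _ = ρ * K * ∑ k ∈ (l n).support, ‖l n k‖ * Real.exp (-dist (X N) (X k)) := by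
          rw [Finset.mul_sum]; refine Finset.sum_congr rfl fun k _ => ?_; ring
      _ ≤ M := by
          rw [hM]
          refine mul_le_mul_of_nonneg_left ?_ (by positivity)
          apply Real.le_sqrt_of_sq_le
          refine (Finset.sum_mul_sq_le_sq_mul_sq _ _ _).trans ?_
          refine mul_le_mul (hQ n) ?_ (Finset.sum_nonneg fun _ _ => by positivity) (by positivity)
          refine le_trans (le_of_eq ?_) (hsN.sum_le_tsum (l n).support
            (fun k _ => by split_ifs <;> positivity))
          refine Finset.sum_congr rfl fun k hk => ?_
          rw [if_neg (hne k hk).symm, ← Real.exp_nat_mul]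
          congr 1; push_cast; ring
  have hpt : ∀ n, (h n : EuclideanSpace ℝ (Fin 3) → ℂ) =ᵐ[volume] fun x =>
      ∑ k ∈ (l n).support, l n k * ((ρ * (Real.exp (-dist x (X k)) / dist x (X k)) : ℝ) : ℂ) := by
    intro n
    rw [← hlh n]
    have a1 := Lp.coeFn_finsetSum (l n).support (fun k => l n k • f k)
    have a2 : ∀ᵐ x, ∀ k, (l n k • f k : Lp ℂ 2 (volume : Measure (EuclideanSpace ℝ (Fin 3)))) x =
        l n k * ((ρ * (Real.exp (-dist x (X k)) / dist x (X k)) : ℝ) : ℂ) := by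
      rw [ae_all_iff]
      intro k
      filter_upwards [Lp.coeFn_smul (l n k) (f k), hf k] with x h1 h2
      rw [h1, Pi.smul_apply, h2, smul_eq_mul]
    filter_upwards [a1, a2] with x h1 h2
    rw [h1, Finset.sum_apply]
    exact Finset.sum_congr rfl fun k _ => h2 k
  obtain ⟨ns, -, hns⟩ := (tendstoInMeasure_of_tendsto_Lp hlim).exists_seq_tendsto_ae
  have hfin : ∀ᵐ x, dist x (X N) < δ → ρ * (Real.exp (-dist x (X N)) / dist x (X N)) ≤ M := by
    filter_upwards [hns, ae_all_iff.2 hpt, hf N] with x h1 h2 h3 hx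
    have : ‖(f N : EuclideanSpace ℝ (Fin 3) → ℂ) x‖ ≤ M := by
      refine le_of_tendsto' h1.norm fun i => ?_
      rw [h2]
      exact hbound _ x hx
    rwa [h3, Complex.norm_real, Real.norm_of_nonneg (by positivity)] at this
  have hM0 : 0 ≤ M := by positivity
  set ε := min δ (ρ * Real.exp (-δ) / (M + 1)) with hε
  have hε0 : 0 < ε := by positivity
  have hball : volume (Metric.ball (X N) ε) = 0 := by
    have hne : ∀ᵐ x : EuclideanSpace ℝ (Fin 3), x ≠ X N := by simp [ae_iff]
    have : ∀ᵐ x, x ∉ Metric.ball (X N) ε := by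
      filter_upwards [hfin, hne] with x h1 h2 h3
      rw [Metric.mem_ball] at h3
      have hd0 := dist_pos.2 h2
      have hdδ : dist x (X N) < δ := h3.trans_le (min_le_left _ _)
      have hd2 : dist x (X N) < ρ * Real.exp (-δ) / (M + 1) := h3.trans_le (min_le_right _ _)
      have h4 := h1 hdδ
      rw [lt_div_iff₀ (by positivity)] at hd2
      rw [← mul_div_assoc, div_le_iff₀ hd0] at h4
      have : ρ * Real.exp (-δ) ≤ ρ * Real.exp (-dist x (X N)) := by gcongr
      nlinarith
    rw [ae_iff] at this
    convert this using 2
    ext x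
    simp
  exact (Metric.measure_ball_pos volume (X N) hε0).ne' hball

set_option maxHeartbeats 2000000 in
/-- Let `X` be a sequence of pairwise distinct points of `ℝ³` with no
finite accumulation point and let `φ_j(x) = e^{−|x−x_j|}/|x−x_j| ∈ L²(ℝ³)`. Then the
normalized sequence `{(2π)^{−1/2} φ_j}` forms a Bari basis of the closure of its linear
span — i.e. there is an orthonormal basis `{g_j}` of that closed subspace with
`∑_j ‖(2π)^{−1/2} φ_j − g_j‖² < ∞` — iff `∑_{j≠k} e^{−2|x_j−x_k|} < ∞`. -/
theorem statement_19 (X : ℕ → EuclideanSpace ℝ (Fin 3)) (hX : Function.Injective X)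
    (hacc : ∀ y : EuclideanSpace ℝ (Fin 3), ¬ AccPt y (Filter.principal (Set.range X)))
    (φ : ℕ → Lp ℂ 2 (volume : Measure (EuclideanSpace ℝ (Fin 3))))
    (hφ : ∀ j, (φ j : EuclideanSpace ℝ (Fin 3) → ℂ) =ᵐ[volume] fun x =>
      ((Real.exp (-dist x (X j)) / dist x (X j) : ℝ) : ℂ)) :
    (∃ g : HilbertBasis ℕ ℂ ((Submodule.span ℂ (Set.range φ)).topologicalClosure),
        Summable fun j =>
          ‖(Real.sqrt (2 * Real.pi))⁻¹ • φ j -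
            ((g j : (Submodule.span ℂ (Set.range φ)).topologicalClosure) :
              Lp ℂ 2 (volume : Measure (EuclideanSpace ℝ (Fin 3))))‖ ^ 2) ↔
      Summable fun p : ℕ × ℕ =>
        if p.1 = p.2 then (0 : ℝ) else Real.exp (-(2 * dist (X p.1) (X p.2))) := by
  have hpi : 0 < 2 * Real.pi := by positivity
  set ρ := (Real.sqrt (2 * Real.pi))⁻¹ with hρ
  have hρ0 : 0 < ρ := by positivity
  have hρ2 : ρ ^ 2 * (2 * Real.pi) = 1 := by
    rw [hρ, inv_pow, Real.sq_sqrt hpi.le, inv_mul_cancel₀ hpi.ne']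
  set f : ℕ → Lp ℂ 2 (volume : Measure (EuclideanSpace ℝ (Fin 3))) := fun j => ρ • φ j with hfdef
  have hfc : ∀ j, f j = (ρ : ℂ) • φ j := fun j => (Complex.coe_smul ρ (φ j)).symm
  have hin : ∀ j k, inner ℂ (f j) (f k) = ((Real.exp (-dist (X j) (X k)) : ℝ) : ℂ) := by
    intro j k
    rw [hfc, hfc, inner_smul_left, inner_smul_right, aux_inner X φ hφ, Complex.conj_ofReal,
      ← Complex.ofReal_mul, ← Complex.ofReal_mul]
    congr 1
    linear_combination Real.exp (-dist (X j) (X k)) * hρ2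
  have hin2 : (fun p : ℕ × ℕ => if p.1 = p.2 then (0 : ℝ) else ‖inner ℂ (f p.1) (f p.2)‖ ^ 2) =
      fun p : ℕ × ℕ =>
        if p.1 = p.2 then (0 : ℝ) else Real.exp (-(2 * dist (X p.1) (X p.2))) := by
    ext p
    split_ifs
    · rfl
    · rw [hin, Complex.norm_real, Real.norm_of_nonneg (Real.exp_pos _).le, ← Real.exp_nat_mul]
      congr 1; push_cast; ring
  have hn1 : ∀ j, ‖f j‖ = 1 := by
    intro j
    have h := inner_self_eq_norm_sq (𝕜 := ℂ) (f j)
    rw [hin, dist_self, neg_zero, Real.exp_zero] at h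
    have h2 : ‖f j‖ ^ 2 = 1 := by rw [← h]; simp
    exact (pow_eq_one_iff_of_nonneg (norm_nonneg _) two_ne_zero).1 h2
  have hf : ∀ j, (f j : EuclideanSpace ℝ (Fin 3) → ℂ) =ᵐ[volume] fun x =>
      ((ρ * (Real.exp (-dist x (X j)) / dist x (X j)) : ℝ) : ℂ) := by
    intro j
    rw [hfc]
    filter_upwards [Lp.coeFn_smul (ρ : ℂ) (φ j), hφ j] with x h1 h2
    rw [h1, Pi.smul_apply, h2, smul_eq_mul]
    push_cast; ring
  rw [← hin2]
  constructor
  · rintro ⟨g, hg⟩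
    refine aux_bari_forward f (fun j => ((g j : (Submodule.span ℂ (Set.range φ)).topologicalClosure) :
              Lp ℂ 2 (volume : Measure (EuclideanSpace ℝ (Fin 3))))) ?_ hg
    exact g.orthonormal.comp_linearIsometry (Submodule.subtypeₗᵢ _)
  · intro hs
    have hs' := hs
    rw [hin2] at hs'
    obtain ⟨N, hN⟩ := aux_tail f hn1 hs
    have hRF : TailRF f 0 := by
      clear_value f
      induction N with
      | zero => exact hN
      | succ N ih => exact ih (aux_step f N hN (aux_notin X hX hacc f ρ hρ0 hf hs' N hN))
    have hspan : Submodule.span ℂ (Set.range f) = Submodule.span ℂ (Set.range φ) := by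
      have hu : (ρ : ℂ) ≠ 0 := by exact_mod_cast hρ0.ne'
      apply le_antisymm
      · rw [Submodule.span_le]
        rintro _ ⟨j, rfl⟩
        rw [hfc]
        exact Submodule.smul_mem _ _ (Submodule.subset_span ⟨j, rfl⟩)
      · rw [Submodule.span_le]
        rintro _ ⟨j, rfl⟩
        have : φ j = (ρ : ℂ)⁻¹ • f j := by rw [hfc, inv_smul_smul₀ hu]
        rw [this]
        exact Submodule.smul_mem _ _ (Submodule.subset_span ⟨j, rfl⟩)
    exact aux_bari_backward f hn1 hRF hs _ hspan
end
end
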